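/- Let a ∈ ℝ² and y > 0, and define f : ℝ² → ℝ by f(x) = |y − ‖x − a‖|. Then the set of points at which f is not differentiable equals {a} ∪ {x ∈ ℝ² : ‖x − a‖ = y}. -/

import Mathlib

/-- for `y > 0`, the set of non-differentiability points of the deviation
loss `x ↦ |y − ‖x − a‖|` is exactly the anchor together with the circle of radius `y`. -/
theorem deviation_loss_nondifferentiable_set
    (a : EuclideanSpace ℝ (Fin 2)) (y : ℝ) (hy : 0 < y)
    (f : EuclideanSpace ℝ (Fin 2) → ℝ)
    (hf : ∀ x, f x = |y - ‖x - a‖|) :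
    {x | ¬ DifferentiableAt ℝ f x} = {a} ∪ {x | ‖x - a‖ = y} := by
  ext x
  simp only [Set.mem_setOf_eq, Set.mem_union, Set.mem_singleton_iff]
  constructor
  · intro h
    by_contra! hc
    obtain ⟨h1, h2⟩ := hc
    apply h
    have hfe : f = fun x => |y - ‖x - a‖| := funext hf
    rw [hfe]
    have hd : DifferentiableAt ℝ (fun x : EuclideanSpace ℝ (Fin 2) => ‖x - a‖) x :=
      DifferentiableAt.norm ℝ (by fun_prop) (sub_ne_zero.mpr h1)
    exact (hd.const_sub y).abs (sub_ne_zero.mpr (Ne.symm h2))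
  · rintro (rfl | h) hd
    · apply not_differentiableAt_norm_zero (EuclideanSpace ℝ (Fin 2))
      have h1 : DifferentiableAt ℝ (fun v => y - f (x + v)) 0 := by
        apply DifferentiableAt.const_sub
        apply DifferentiableAt.comp (g := f)
        · simpa using hd
        · fun_prop
      refine h1.congr_of_eventuallyEq ?_
      filter_upwards [Metric.ball_mem_nhds _ hy] with v hv
      rw [mem_ball_zero_iff] at hv
      rw [hf, add_sub_cancel_left, abs_of_pos (by linarith)]
      ring
    · apply not_differentiableAt_abs_zero
      have h1 : DifferentiableAt ℝ (fun t : ℝ => y⁻¹ * f (x + t • (x - a))) 0 := by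
        apply DifferentiableAt.const_mul
        apply DifferentiableAt.comp (g := f)
        · simpa using hd
        · fun_prop
      refine h1.congr_of_eventuallyEq ?_
      filter_upwards [Metric.ball_mem_nhds _ one_pos] with t ht
      rw [mem_ball_zero_iff, Real.norm_eq_abs, abs_lt] at ht
      have e : x + t • (x - a) - a = (1 + t) • (x - a) := by module
      rw [hf, e, norm_smul, h, Real.norm_eq_abs, abs_of_pos (by linarith : 0 < 1 + t)]
      have e2 : y - (1 + t) * y = -(y * t) := by ring
      rw [e2, abs_neg, abs_mul, abs_of_pos hy]
      field_simp
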